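/- Fix integers k ≥ 2 and p ≥ 1, let (w_{1,n}, …, w_{p,n}) be independent F_k-valued random variables satisfying radial symmetry, positive drift with drift constant L > 0, and subexponential growth, fix β with 0 < β < L/2, and let φ be a relabeling automorphism of F_k other than the identity. Then with probability going to 1 exponentially fast as n → ∞: there is no reduced word u of length ⌊βn⌋ such that u is a subword of the reduced word of some w_{i,n}^{±1} and φ(u) is a subword of the reduced word of some w_{j,n}^{±1}. -/

import Mathlib

open MeasureTheory

noncomputable section

/-- Every set of a free group is measurable (discrete σ-algebra). -/
instance freeGroupMeasurableSpace {α : Type*} : MeasurableSpace (FreeGroup α) := ⊤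

/-- The length `|g|` of the reduced word representing `g`. -/
def wlen {k : ℕ} (g : FreeGroup (Fin k)) : ℕ := (FreeGroup.toWord g).length

/-- The reduced word of `g` (if `ε = true`) or of `g⁻¹` (if `ε = false`). -/
def signedWord {k : ℕ} (g : FreeGroup (Fin k)) (ε : Bool) : List (Fin k × Bool) :=
  FreeGroup.toWord (if ε then g else g⁻¹)

/-- A family of "failure probabilities" decays exponentially: the corresponding events
hold with probability going to 1 exponentially fast as `n → ∞`. -/
def ExpDecay (f : ℕ → ENNReal) : Prop :=
  ∃ C : ℝ, 0 < C ∧ ∃ κ : ℝ, 1 < κ ∧ ∀ n : ℕ, f n ≤ ENNReal.ofReal (C / κ ^ n)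

/-- An automorphism of `F_k` is a relabeling automorphism if it maps the set of letters
`X^{±1}` (encoded as one-letter words `FreeGroup.mk [a]`, `a : Fin k × Bool`) into itself. -/
def IsRelabeling {k : ℕ} (φ : FreeGroup (Fin k) ≃* FreeGroup (Fin k)) : Prop :=
  ∀ a : Fin k × Bool, ∃ b : Fin k × Bool, φ (FreeGroup.mk [a]) = FreeGroup.mk [b]

open scoped Classical in
/-- The words of length `ℓ` satisfying `T`. -/
def level {α : Type*} [Fintype α] (T : List α → Prop) (ℓ : ℕ) : Finset (List α) :=
  (List.finite_length_eq α ℓ).toFinset.filter T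

lemma mem_level {α : Type*} [Fintype α] {T : List α → Prop} {ℓ : ℕ} {w : List α} :
    w ∈ level T ℓ ↔ w.length = ℓ ∧ T w := by
  simp [level]

open scoped Classical in
lemma card_level_succ {α : Type*} [Fintype α] {T : List α → Prop}
    (hT : ∀ v a, T (v ++ [a]) → T v) (ℓ : ℕ) :
    (level T (ℓ + 1)).card =
      ∑ v ∈ level T ℓ, (Finset.univ.filter fun a => T (v ++ [a])).card := by
  rw [Finset.card_eq_sum_card_fiberwise (f := List.dropLast) (t := level T ℓ)]
  · refine Finset.sum_congr rfl fun v hv => ?_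
    rw [mem_level] at hv
    rw [← Finset.card_image_of_injective (f := fun a : α => v ++ [a]) _
      (fun a b h => by simpa using h)]
    congr 1
    ext w
    simp only [Finset.mem_filter, mem_level, Finset.mem_image, Finset.mem_univ, true_and]
    constructor
    · rintro ⟨⟨hl, hw⟩, rfl⟩
      have hne : w ≠ [] := by rintro rfl; simp at hl
      exact ⟨w.getLast hne, by rwa [List.dropLast_append_getLast],
        List.dropLast_append_getLast hne⟩
    · rintro ⟨a, ha, rfl⟩
      exact ⟨⟨by simp [hv.1], ha⟩, by simp⟩
  · intro w hw
    simp only [Finset.mem_coe, mem_level] at hw ⊢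
    have hne : w ≠ [] := by rintro rfl; simp at hw
    refine ⟨by simp [hw.1], hT _ (w.getLast hne) ?_⟩
    rw [List.dropLast_append_getLast]
    exact hw.2

lemma isReduced_concat {α : Type*} {v : List (α × Bool)} {a : α × Bool} :
    FreeGroup.IsReduced (v ++ [a]) ↔
      FreeGroup.IsReduced v ∧ ∀ b ∈ v.getLast?, b.1 = a.1 → b.2 = a.2 := by
  simp [FreeGroup.IsReduced, List.isChain_append]

/-- The inverse of a letter. -/
def invLetter {α : Type*} (a : α × Bool) : α × Bool := (a.1, !a.2)

lemma eq_invLetter_iff {α : Type*} {a b : α × Bool} :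
    a = invLetter b ↔ ¬ (b.1 = a.1 → b.2 = a.2) := by
  obtain ⟨a, x⟩ := a
  obtain ⟨b, y⟩ := b
  cases x <;> cases y <;> simp [invLetter, eq_comm]

open scoped Classical in
lemma card_extensions {k : ℕ} {v : List (Fin k × Bool)} (hv : FreeGroup.IsReduced v) :
    (Finset.univ.filter fun a => FreeGroup.IsReduced (v ++ [a])).card =
      if v = [] then 2 * k else 2 * k - 1 := by
  have hcard : Fintype.card (Fin k × Bool) = 2 * k := by simp [mul_comm]
  split_ifs with h
  · subst h
    rw [Finset.filter_true_of_mem (by simp), Finset.card_univ, hcard]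
  · have : (Finset.univ.filter fun a => FreeGroup.IsReduced (v ++ [a])) =
        Finset.univ.erase (invLetter (v.getLast h)) := by
      ext a
      simp [isReduced_concat, hv, List.getLast?_eq_getLast_of_ne_nil h, eq_invLetter_iff]
    rw [this, Finset.card_erase_of_mem (Finset.mem_univ _), Finset.card_univ, hcard]

lemma pow_le_card_sphere (k ℓ : ℕ) :
    (2 * k - 1) ^ ℓ ≤ (level (FreeGroup.IsReduced (α := Fin k)) ℓ).card := by
  classical
  induction ℓ with
  | zero =>
    rw [pow_zero, Nat.one_le_iff_ne_zero, Finset.card_ne_zero]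
    exact ⟨[], mem_level.2 ⟨rfl, by simp⟩⟩
  | succ ℓ ih =>
    rw [card_level_succ fun v a h => (isReduced_concat.1 h).1, pow_succ]
    refine (Nat.mul_le_mul_right _ ih).trans (Finset.card_nsmul_le_sum _ _ _ fun v hv => ?_)
    rw [card_extensions (mem_level.1 hv).2]
    split_ifs <;> omega

/-- The letter of `w` at each position in `P` is in the relation `C` with the preceding word. -/
def Constrained {α : Type*} (P : Finset ℕ) (C : List α → α → Prop) (w : List α) : Prop :=
  ∀ q ∈ P, ∀ a, w[q]? = some a → C (w.take q) a

lemma constrained_concat {α : Type*} {P : Finset ℕ} {C : List α → α → Prop} {v : List α} {a : α} :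
    Constrained P C (v ++ [a]) ↔ Constrained P C v ∧ (v.length ∈ P → C v a) := by
  constructor
  · refine fun h => ⟨fun q hq b hb => ?_, fun hq => ?_⟩
    · have hlt := (List.getElem?_eq_some_iff.1 hb).1
      have := h q hq b (by rwa [List.getElem?_append_left hlt])
      rwa [List.take_append_of_le_length hlt.le] at this
    · simpa using h _ hq a (by simp)
  · rintro ⟨h, h'⟩ q hq b hb
    rcases lt_trichotomy q v.length with hlt | rfl | hlt
    · rw [List.take_append_of_le_length hlt.le]
      rw [List.getElem?_append_left hlt] at hb
      exact h q hq b hb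
    · simp at hb
      subst hb
      simpa using h' hq
    · rw [List.getElem?_eq_none (by simp; omega)] at hb
      simp at hb

/-- The proportion of letters remaining available at a constrained position. -/
def ratio (k : ℕ) : ℝ := (2 * k - 2) / (2 * k - 1)

open scoped Classical in
lemma card_constrained_le {k : ℕ} (hk : 2 ≤ k) (P : Finset ℕ)
    (C : List (Fin k × Bool) → Fin k × Bool → Prop)
    (hC : ∀ v, v.length ∈ P → (Finset.univ.filter (C v)).card ≤ 2 * k - 2) (ℓ : ℕ) :
    ((level (fun w => FreeGroup.IsReduced w ∧ Constrained P C w) ℓ).card : ℝ) ≤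
      ∏ q ∈ Finset.range ℓ, ((2 * k - 1 : ℝ) * ((if q = 0 then 2 else 1) *
        (if q ∈ P then ratio k else 1))) := by
  have hk' : (2 : ℝ) ≤ k := by exact_mod_cast hk
  induction ℓ with
  | zero =>
    rw [Finset.range_zero, Finset.prod_empty, Nat.cast_le_one]
    refine (Finset.card_le_card (t := {[]}) fun w hw => ?_).trans (by simp)
    simpa using (mem_level.1 hw).1
  | succ ℓ ih =>
    rw [card_level_succ fun v a h =>
      ⟨(isReduced_concat.1 h.1).1, (constrained_concat.1 h.2).1⟩, Finset.prod_range_succ,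
      Nat.cast_sum]
    refine (Finset.sum_le_card_nsmul _ _ ((2 * k - 1 : ℝ) * ((if ℓ = 0 then 2 else 1) *
        (if ℓ ∈ P then ratio k else 1))) fun v hv => ?_).trans ?_
    rotate_left
    · rw [nsmul_eq_mul]
      refine mul_le_mul_of_nonneg_right ih ?_
      have : 0 ≤ ratio k := div_nonneg (by linarith) (by linarith)
      have : (0 : ℝ) ≤ 2 * k - 1 := by linarith
      positivity
    obtain ⟨rfl, hv, hP⟩ := mem_level.1 hv
    by_cases hq : v.length ∈ P
    · have h1 : ((Finset.univ.filter fun a => FreeGroup.IsReduced (v ++ [a]) ∧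
          Constrained P C (v ++ [a])).card : ℝ) ≤ 2 * k - 2 := by
        have := (Finset.card_le_card (Finset.monotone_filter_right Finset.univ
          fun a _ (h : FreeGroup.IsReduced (v ++ [a]) ∧ Constrained P C (v ++ [a])) =>
            (constrained_concat.1 h.2).2 hq)).trans (hC v hq)
        have h2 : ((2 * k - 2 : ℕ) : ℝ) = 2 * k - 2 := by
          rw [Nat.cast_sub (by omega)]; push_cast; ring
        rw [← h2]
        exact_mod_cast this
      refine ((le_of_eq (by congr!)).trans h1).trans ?_
      have h3 : (2 * k - 1 : ℝ) * ratio k = 2 * k - 2 := by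
        rw [ratio, mul_div_cancel₀]; linarith
      rw [if_pos hq, mul_left_comm, h3]
      split_ifs <;> linarith
    · have h1 : ((Finset.univ.filter fun a => FreeGroup.IsReduced (v ++ [a]) ∧
          Constrained P C (v ++ [a])).card : ℝ) ≤ if v = [] then (2 * k : ℝ) else 2 * k - 1 := by
        have := (Finset.card_le_card (Finset.monotone_filter_right Finset.univ
          fun a _ (h : FreeGroup.IsReduced (v ++ [a]) ∧ Constrained P C (v ++ [a])) =>
            h.1)).trans (card_extensions hv).le
        have h2 : ((if v = [] then 2 * k else 2 * k - 1 : ℕ) : ℝ) =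
            if v = [] then (2 * k : ℝ) else 2 * k - 1 := by
          split_ifs
          · push_cast; ring
          · rw [Nat.cast_sub (by omega)]; push_cast; ring
        rw [← h2]
        exact_mod_cast this
      refine ((le_of_eq (by congr!)).trans h1).trans ?_
      simp only [List.length_eq_zero_iff, if_neg hq]
      split_ifs <;> linarith

lemma ratio_pos {k : ℕ} (hk : 2 ≤ k) : 0 < ratio k := by
  have hk' : (2 : ℝ) ≤ k := by exact_mod_cast hk
  exact div_pos (by linarith) (by linarith)

lemma ratio_lt_one {k : ℕ} (hk : 2 ≤ k) : ratio k < 1 := by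
  have hk' : (2 : ℝ) ≤ k := by exact_mod_cast hk
  rw [ratio, div_lt_one (by linarith)]
  linarith

open scoped Classical in
/-- Among the reduced words of a given length, those subject to `d` constraints are rare. -/
lemma card_le_of_constrained {k : ℕ} (hk : 2 ≤ k) {ℓ d : ℕ} {E : List (Fin k × Bool) → Prop}
    (P : Finset ℕ) (C : List (Fin k × Bool) → Fin k × Bool → Prop)
    (hC : ∀ v, v.length ∈ P → (Finset.univ.filter (C v)).card ≤ 2 * k - 2)
    (hP : P ⊆ Finset.range ℓ) (hd : d ≤ P.card)
    (hE : ∀ w, w.length = ℓ → E w → Constrained P C w) :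
    ((level (fun w => FreeGroup.IsReduced w ∧ E w) ℓ).card : ℝ) ≤
      2 * ratio k ^ d * (level (FreeGroup.IsReduced (α := Fin k)) ℓ).card := by
  have hk' : (2 : ℝ) ≤ k := by exact_mod_cast hk
  have hr := ratio_pos hk
  have h1 : ((level (fun w => FreeGroup.IsReduced w ∧ E w) ℓ).card : ℝ) ≤
      (level (fun w => FreeGroup.IsReduced w ∧ Constrained P C w) ℓ).card := by
    refine Nat.cast_le.2 (Finset.card_le_card fun w hw => ?_)
    rw [mem_level] at hw ⊢
    exact ⟨hw.1, hw.2.1, hE w hw.1 hw.2.2⟩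
  have h2 : (2 * k - 1 : ℝ) ^ ℓ ≤ (level (FreeGroup.IsReduced (α := Fin k)) ℓ).card := by
    have h := pow_le_card_sphere k ℓ
    have h3 : ((2 * k - 1 : ℕ) : ℝ) = 2 * k - 1 := by
      rw [Nat.cast_sub (by omega)]; push_cast; ring
    rw [← h3]
    exact_mod_cast h
  have h4 : ∏ q ∈ Finset.range ℓ, (if q = 0 then 2 else 1 : ℝ) ≤ 2 := by
    rw [Finset.prod_ite_eq']
    split_ifs <;> norm_num
  have h5 : ∏ q ∈ Finset.range ℓ, (if q ∈ P then ratio k else 1) = ratio k ^ P.card := by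
    rw [Finset.prod_ite_mem, Finset.inter_eq_right.2 hP, Finset.prod_const]
  refine (h1.trans (card_constrained_le hk P C hC ℓ)).trans ?_
  rw [Finset.prod_mul_distrib, Finset.prod_mul_distrib, h5, Finset.prod_const, Finset.card_range,
    mul_comm]
  have h6 : ratio k ^ P.card ≤ ratio k ^ d := pow_le_pow_of_le_one hr.le (ratio_lt_one hk).le hd
  have h7 : (0 : ℝ) ≤ 2 * k - 1 := by linarith
  gcongr

/-- Among the reduced words of a given length, those in which the letters at `d` positions are
determined by the preceding letters are rare. -/
lemma card_le_of_determined {k : ℕ} (hk : 2 ≤ k) {ℓ d : ℕ} {E : List (Fin k × Bool) → Prop}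
    (D : Finset ℕ) (y : ℕ → ℕ) (F : List (Fin k × Bool) → ℕ → Option (Fin k × Bool))
    (hy : Set.InjOn y D) (hd : d ≤ D.card)
    (hE : ∀ w, w.length = ℓ → E w → ∀ t ∈ D, y t < ℓ ∧ w[y t]? = F (w.take (y t)) t) :
    ((level (fun w => FreeGroup.IsReduced w ∧ E w) ℓ).card : ℝ) ≤
      2 * ratio k ^ d * (level (FreeGroup.IsReduced (α := Fin k)) ℓ).card := by
  classical
  by_cases hD : ∀ t ∈ D, y t < ℓ
  · refine card_le_of_constrained hk (D.image y)
      (fun v a => ∀ t ∈ D, y t = v.length → F v t = some a) (fun v hv => ?_) ?_ ?_ ?_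
    · obtain ⟨t, ht, htv⟩ := Finset.mem_image.1 hv
      refine (Finset.card_le_one.2 fun a ha b hb => ?_).trans (by omega : 1 ≤ 2 * k - 2)
      simp only [Finset.mem_filter, Finset.mem_univ, true_and] at ha hb
      exact Option.some_injective _ ((ha t ht htv).symm.trans (hb t ht htv))
    · intro q hq
      obtain ⟨t, ht, rfl⟩ := Finset.mem_image.1 hq
      exact Finset.mem_range.2 (hD t ht)
    · rwa [Finset.card_image_of_injOn hy]
    · intro w hw hEw q _ a ha t ht htq
      have hlt := (List.getElem?_eq_some_iff.1 ha).1
      rw [List.length_take, min_eq_left hlt.le] at htq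
      subst htq
      rw [← ha, (hE w hw hEw t ht).2]
  · push Not at hD
    obtain ⟨t, ht, htℓ⟩ := hD
    have : level (fun w => FreeGroup.IsReduced w ∧ E w) ℓ = ∅ :=
      Finset.eq_empty_of_forall_notMem fun w hw =>
        absurd (hE w (mem_level.1 hw).1 (mem_level.1 hw).2.2 t ht).1 htℓ.not_gt
    rw [this, Finset.card_empty, Nat.cast_zero]
    have := ratio_pos hk
    positivity

/-- Position `t` of a word of length `m`, read backwards if `r` is true. -/
def place (r : Bool) (m t : ℕ) : ℕ := if r then m - 1 - t else t

/-- The relabeling by `f` of the subword of length `m` of `g` at position `a` is the subword of `h`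
at position `b`, read backwards if `r` is true. -/
def MatchAt {α : Type*} (r : Bool) (m : ℕ) (f : Equiv.Perm α) (a b : ℕ) (g h : List α) : Prop :=
  a + m ≤ g.length ∧ b + m ≤ h.length ∧ ∀ t < m, h[b + place r m t]? = g[a + t]?.map f

lemma place_lt {r : Bool} {m t : ℕ} (ht : t < m) : place r m t < m := by
  unfold place; split_ifs <;> omega

lemma place_injOn (r : Bool) (m : ℕ) : Set.InjOn (place r m) (Finset.range m) := by
  intro s hs t ht h
  simp only [Finset.coe_range, Set.mem_Iio] at hs ht
  unfold place at h
  split_ifs at h <;> omega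

lemma card_matchAt_le {k : ℕ} (hk : 2 ≤ k) (r : Bool) (ℓ m : ℕ) (f : Equiv.Perm (Fin k × Bool))
    (a b : ℕ) (g : List (Fin k × Bool)) :
    ((level (fun w => FreeGroup.IsReduced w ∧ MatchAt r m f a b g w) ℓ).card : ℝ) ≤
      2 * ratio k ^ (m / 2) * (level (FreeGroup.IsReduced (α := Fin k)) ℓ).card := by
  refine card_le_of_determined hk (Finset.range m) (fun t => b + place r m t)
    (fun _ t => g[a + t]?.map f) ?_ (by rw [Finset.card_range]; omega) ?_
  · exact fun s hs t ht h => place_injOn r m hs ht (Nat.add_left_cancel h)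
  · rintro w rfl ⟨-, hb, h⟩ t ht
    have ht := Finset.mem_range.1 ht
    have := place_lt (r := r) ht
    exact ⟨by omega, h t ht⟩

/-- Self-overlap, where the second letter of each pair comes later. -/
lemma card_self_matchAt_le_of_lt {k : ℕ} (hk : 2 ≤ k) (r : Bool) (ℓ m : ℕ)
    (f : Equiv.Perm (Fin k × Bool)) (a b : ℕ) {d : ℕ} (D : Finset ℕ) (hDm : D ⊆ Finset.range m)
    (hd : d ≤ D.card) (hD : ∀ t ∈ D, a + t < b + place r m t) :
    ((level (fun w => FreeGroup.IsReduced w ∧ MatchAt r m f a b w w) ℓ).card : ℝ) ≤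
      2 * ratio k ^ d * (level (FreeGroup.IsReduced (α := Fin k)) ℓ).card := by
  refine card_le_of_determined hk D (fun t => b + place r m t)
    (fun v t => v[a + t]?.map f) ?_ hd ?_
  · exact fun s hs t ht h => place_injOn r m (hDm hs) (hDm ht) (Nat.add_left_cancel h)
  · rintro w rfl ⟨-, hb, h⟩ t ht
    have htm := Finset.mem_range.1 (hDm ht)
    have := place_lt (r := r) htm
    exact ⟨by omega, by rw [List.getElem?_take_of_lt (hD t ht), h t htm]⟩

/-- Self-overlap, where the first letter of each pair comes later. -/
lemma card_self_matchAt_le_of_gt {k : ℕ} (hk : 2 ≤ k) (r : Bool) (ℓ m : ℕ)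
    (f : Equiv.Perm (Fin k × Bool)) (a b : ℕ) {d : ℕ} (D : Finset ℕ) (hDm : D ⊆ Finset.range m)
    (hd : d ≤ D.card) (hD : ∀ t ∈ D, b + place r m t < a + t) :
    ((level (fun w => FreeGroup.IsReduced w ∧ MatchAt r m f a b w w) ℓ).card : ℝ) ≤
      2 * ratio k ^ d * (level (FreeGroup.IsReduced (α := Fin k)) ℓ).card := by
  refine card_le_of_determined hk D (fun t => a + t)
    (fun v t => v[b + place r m t]?.map f.symm) ?_ hd ?_
  · exact fun s _ t _ h => Nat.add_left_cancel h
  · rintro w rfl ⟨ha, -, h⟩ t ht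
    have htm := Finset.mem_range.1 (hDm ht)
    refine ⟨by omega, ?_⟩
    rw [List.getElem?_take_of_lt (hD t ht), h t htm, Option.map_map]
    simp

lemma half_le_card_filter (m : ℕ) : m / 2 ≤ ((Finset.range m).filter (2 * · + 1 < m)).card := by
  calc m / 2 = (Finset.range (m / 2)).card := (Finset.card_range _).symm
    _ ≤ _ := Finset.card_le_card fun t ht => by
      simp only [Finset.mem_range, Finset.mem_filter] at ht ⊢
      omega

lemma half_le_card_filter' (m : ℕ) : m / 2 ≤ ((Finset.range m).filter (m ≤ 2 * · + 1)).card := by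
  calc m / 2 = (Finset.Ico (m - m / 2) m).card := by rw [Nat.card_Ico]; omega
    _ ≤ _ := Finset.card_le_card fun t ht => by
      simp only [Finset.mem_Ico, Finset.mem_range, Finset.mem_filter] at ht ⊢
      omega

lemma card_self_matchAt_le {k : ℕ} (hk : 2 ≤ k) (r : Bool) (ℓ m : ℕ)
    (f : Equiv.Perm (Fin k × Bool))
    (hf : r = false → f ≠ 1 ∧ ∀ a, f (invLetter a) = invLetter (f a)) (a b : ℕ) :
    ((level (fun w => FreeGroup.IsReduced w ∧ MatchAt r m f a b w w) ℓ).card : ℝ) ≤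
      2 * ratio k ^ (m / 2) * (level (FreeGroup.IsReduced (α := Fin k)) ℓ).card := by
  classical
  cases r with
  | true =>
    rcases le_or_gt a b with hab | hab
    · refine card_self_matchAt_le_of_lt hk true ℓ m f a b _ (Finset.filter_subset _ _)
        (half_le_card_filter m) fun t ht => ?_
      simp only [Finset.mem_filter, Finset.mem_range] at ht
      simp only [place, if_true]
      omega
    · refine card_self_matchAt_le_of_gt hk true ℓ m f a b _ (Finset.filter_subset _ _)
        (half_le_card_filter' m) fun t ht => ?_
      simp only [Finset.mem_filter, Finset.mem_range] at ht
      simp only [place, if_true]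
      omega
  | false =>
    have hm : m / 2 ≤ (Finset.range m).card := by rw [Finset.card_range]; omega
    rcases lt_trichotomy a b with hab | rfl | hab
    · exact card_self_matchAt_le_of_lt hk false ℓ m f a b _ subset_rfl hm fun t _ => by
        simpa [place] using hab
    · obtain ⟨hf1, hfinv⟩ := hf rfl
      obtain ⟨x, hx⟩ : ∃ x, f x ≠ x := by
        by_contra! h
        exact hf1 (Equiv.ext h)
      by_cases hℓ : a + m ≤ ℓ
      · refine card_le_of_constrained hk (Finset.Ico a (a + m)) (fun _ c => f c = c)
          (fun v _ => ?_) (fun q hq => ?_) (by rw [Nat.card_Ico]; omega) ?_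
        · have hne : x ≠ invLetter x := by
            intro h
            simpa [invLetter] using congrArg Prod.snd h
          have hx' : f (invLetter x) ≠ invLetter x := by
            rw [hfinv]
            intro h
            apply hx
            have := congrArg invLetter h
            simpa [invLetter] using this
          calc _ ≤ ((Finset.univ.erase x).erase (invLetter x)).card :=
                Finset.card_le_card fun c hc => by
                  simp only [Finset.mem_filter, Finset.mem_univ, true_and] at hc
                  simp only [Finset.mem_erase, Finset.mem_univ, and_true]
                  exact ⟨by rintro rfl; exact hx' hc, by rintro rfl; exact hx hc⟩
            _ = 2 * k - 2 := by
              rw [Finset.card_erase_of_mem (by simp [hne.symm]),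
                Finset.card_erase_of_mem (Finset.mem_univ _), Finset.card_univ]
              simp only [Fintype.card_prod, Fintype.card_fin, Fintype.card_bool]
              omega
        · simp only [Finset.mem_Ico, Finset.mem_range] at hq ⊢
          omega
        · rintro w rfl ⟨-, -, h⟩ q hq c hc
          rw [Finset.mem_Ico] at hq
          have := h (q - a) (by omega)
          simp only [place, Bool.false_eq_true, if_false, Nat.add_sub_cancel' hq.1, hc] at this
          simpa using this.symm
      · have : level (fun w => FreeGroup.IsReduced w ∧ MatchAt false m f a a w w) ℓ = ∅ :=
          Finset.eq_empty_of_forall_notMem fun w hw => by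
            obtain ⟨rfl, -, h, -⟩ := mem_level.1 hw
            exact hℓ h
        rw [this, Finset.card_empty, Nat.cast_zero]
        have := ratio_pos hk
        positivity
    · exact card_self_matchAt_le_of_gt hk false ℓ m f a b _ subset_rfl hm fun t _ => by
        simpa [place] using hab

section Relabeling

variable {k : ℕ}

lemma mk_invLetter (a : Fin k × Bool) :
    FreeGroup.mk [invLetter a] = (FreeGroup.mk [a])⁻¹ := by
  simp [FreeGroup.inv_mk, FreeGroup.invRev, invLetter]

lemma mk_singleton_injective :
    Function.Injective fun a : Fin k × Bool => FreeGroup.mk [a] := by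
  intro a b h
  have := congrArg FreeGroup.toWord h
  simpa [FreeGroup.toWord_mk, FreeGroup.reduce_singleton] using this

/-- The permutation of the letters induced by a relabeling automorphism. -/
lemma IsRelabeling.exists_perm {φ : FreeGroup (Fin k) ≃* FreeGroup (Fin k)}
    (hφ : IsRelabeling φ) :
    ∃ f : Equiv.Perm (Fin k × Bool), (∀ a, f (invLetter a) = invLetter (f a)) ∧
      ∀ u, φ (FreeGroup.mk u) = FreeGroup.mk (u.map f) := by
  choose f hf using hφ
  have hinj : Function.Injective f := fun a b h =>
    mk_singleton_injective (φ.injective (by simp only [hf, h]))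
  refine ⟨Equiv.ofBijective f (Finite.injective_iff_bijective.1 hinj), fun a => ?_, fun u => ?_⟩
  · apply mk_singleton_injective
    simp only [Equiv.ofBijective_apply]
    rw [← hf, mk_invLetter, map_inv, hf, mk_invLetter]
  · induction u with
    | nil => simp [← FreeGroup.one_eq_mk]
    | cons a u ih =>
      rw [← List.singleton_append, ← FreeGroup.mul_mk, map_mul, ih, hf, FreeGroup.mul_mk]
      simp

lemma isReduced_map {f : Equiv.Perm (Fin k × Bool)}
    (hf : ∀ a, f (invLetter a) = invLetter (f a)) {u : List (Fin k × Bool)}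
    (hu : FreeGroup.IsReduced u) : FreeGroup.IsReduced (u.map f) := by
  refine List.isChain_map_of_isChain f (fun a b h => ?_) hu
  by_contra h'
  rw [← eq_invLetter_iff, ← hf] at h'
  exact eq_invLetter_iff.1 (f.injective h') h

lemma invRev_eq (u : List (Fin k × Bool)) :
    FreeGroup.invRev u = (u.map invLetter).reverse := rfl

lemma invRev_map {f : Equiv.Perm (Fin k × Bool)}
    (hf : ∀ a, f (invLetter a) = invLetter (f a)) (u : List (Fin k × Bool)) :
    FreeGroup.invRev (u.map f) = (FreeGroup.invRev u).map f := by
  simp [invRev_eq, List.map_reverse, Function.comp_def, hf]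

lemma invRev_infix {u v : List (Fin k × Bool)} (h : u <:+: v) :
    FreeGroup.invRev u <:+: FreeGroup.invRev v := by
  rw [invRev_eq, invRev_eq, List.reverse_infix]
  exact h.map _

lemma infix_signedWord {u : List (Fin k × Bool)} {g : FreeGroup (Fin k)} {ε : Bool}
    (h : u <:+: signedWord g ε) :
    (if ε then u else FreeGroup.invRev u) <:+: g.toWord := by
  cases ε with
  | true => simpa [signedWord] using h
  | false => simpa [signedWord, FreeGroup.invRev_invRev] using invRev_infix h

lemma exists_getElem?_of_infix {α : Type*} {u w : List α} (h : u <:+: w) :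
    ∃ a, a + u.length ≤ w.length ∧ ∀ t < u.length, w[a + t]? = u[t]? := by
  obtain ⟨s, t, rfl⟩ := h
  refine ⟨s.length, by simp, fun i hi => ?_⟩
  rw [List.append_assoc, List.getElem?_append_right (by omega), Nat.add_sub_cancel_left,
    List.getElem?_append_left hi]

/-- Inversion of letters, as a permutation. -/
def invPerm (k : ℕ) : Equiv.Perm (Fin k × Bool) :=
  ⟨invLetter, invLetter, fun a => by simp [invLetter], fun a => by simp [invLetter]⟩

lemma exists_matchAt_of_infix {f : Equiv.Perm (Fin k × Bool)} {u g h : List (Fin k × Bool)}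
    (hg : u <:+: g) (hh : u.map f <:+: h) : ∃ a b, MatchAt false u.length f a b g h := by
  obtain ⟨a, ha, hga⟩ := exists_getElem?_of_infix hg
  obtain ⟨b, hb, hhb⟩ := exists_getElem?_of_infix hh
  rw [List.length_map] at hb hhb
  refine ⟨a, b, ha, hb, fun t ht => ?_⟩
  simp [place, hga t ht, hhb t ht]

lemma exists_matchAt_of_invRev_infix {f : Equiv.Perm (Fin k × Bool)}
    {u g h : List (Fin k × Bool)} (hg : u <:+: g) (hh : (FreeGroup.invRev u).map f <:+: h) :
    ∃ a b, MatchAt true u.length ((invPerm k).trans f) a b g h := by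
  obtain ⟨a, ha, hga⟩ := exists_getElem?_of_infix hg
  obtain ⟨b, hb, hhb⟩ := exists_getElem?_of_infix hh
  rw [List.length_map, FreeGroup.invRev_length] at hb hhb
  refine ⟨a, b, ha, hb, fun t ht => ?_⟩
  rw [place, if_pos rfl, hhb _ (by omega), hga t ht, List.getElem?_map, invRev_eq,
    List.getElem?_reverse (by simp; omega), List.getElem?_map, List.length_map,
    show u.length - 1 - (u.length - 1 - t) = t by omega, Option.map_map]
  rfl

/-- A common relabeled subword gives rise to matching positions. -/
lemma exists_matchAt {φ : FreeGroup (Fin k) ≃* FreeGroup (Fin k)} {f : Equiv.Perm (Fin k × Bool)}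
    (hf : ∀ a, f (invLetter a) = invLetter (f a))
    (hφ : ∀ u, φ (FreeGroup.mk u) = FreeGroup.mk (u.map f)) {u : List (Fin k × Bool)}
    (hu : FreeGroup.reduce u = u) {g h : FreeGroup (Fin k)} {ε δ : Bool}
    (hg : u <:+: signedWord g ε) (hh : FreeGroup.toWord (φ (FreeGroup.mk u)) <:+: signedWord h δ) :
    ∃ r a b, MatchAt r u.length (if r then (invPerm k).trans f else f) a b g.toWord h.toWord := by
  rw [hφ, FreeGroup.toWord_mk,
    (isReduced_map hf (FreeGroup.isReduced_iff_reduce_eq.2 hu)).reduce_eq] at hh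
  have hg := infix_signedWord hg
  have hh := infix_signedWord hh
  cases ε <;> cases δ <;> simp only [Bool.false_eq_true, if_false, if_true, invRev_map hf] at hg hh
  · refine ⟨false, ?_⟩
    simpa [FreeGroup.invRev_length] using exists_matchAt_of_infix hg hh
  · refine ⟨true, ?_⟩
    rw [← FreeGroup.invRev_invRev (L₁ := u)] at hh
    simpa [FreeGroup.invRev_length] using exists_matchAt_of_invRev_infix hg hh
  · exact ⟨true, exists_matchAt_of_invRev_infix hg hh⟩
  · exact ⟨false, exists_matchAt_of_infix hg hh⟩

end Relabeling

section Radial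

variable {k : ℕ}

instance : Countable (FreeGroup (Fin k)) := FreeGroup.toWord_injective.countable

instance : DiscreteMeasurableSpace (FreeGroup (Fin k)) := ⟨fun _ => trivial⟩

lemma toWord_mk_of_mem {T : List (Fin k × Bool) → Prop} {ℓ : ℕ} {w : List (Fin k × Bool)}
    (hw : w ∈ level (fun w => FreeGroup.IsReduced w ∧ T w) ℓ) :
    (FreeGroup.mk w).toWord = w := by
  rw [FreeGroup.toWord_mk, (mem_level.1 hw).2.1.reduce_eq]

/-- On a sphere a radial measure is a multiple of the counting measure. -/
lemma exists_measure_eq_card_mul {μ : Measure (FreeGroup (Fin k))}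
    (hμ : ∀ g g', wlen g = wlen g' → μ {g} = μ {g'}) (ℓ : ℕ) :
    ∃ c, ∀ T : List (Fin k × Bool) → Prop, μ {g | wlen g = ℓ ∧ T g.toWord} =
      (level (fun w => FreeGroup.IsReduced w ∧ T w) ℓ).card * c := by
  classical
  obtain ⟨c, hc⟩ : ∃ c, ∀ g, wlen g = ℓ → μ {g} = c := by
    by_cases h : ∃ g : FreeGroup (Fin k), wlen g = ℓ
    · obtain ⟨g₀, hg₀⟩ := h
      exact ⟨μ {g₀}, fun g hg => hμ g g₀ (hg.trans hg₀.symm)⟩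
    · push Not at h
      exact ⟨0, fun g hg => absurd hg (h g)⟩
  refine ⟨c, fun T => ?_⟩
  have : {g : FreeGroup (Fin k) | wlen g = ℓ ∧ T g.toWord} =
      ((level (fun w => FreeGroup.IsReduced w ∧ T w) ℓ).image FreeGroup.mk :
        Finset (FreeGroup (Fin k))) := by
    ext g
    simp only [Set.mem_ofPred_eq, Finset.coe_image, Set.mem_image, Finset.mem_coe]
    constructor
    · exact fun h => ⟨g.toWord, mem_level.2 ⟨h.1, FreeGroup.isReduced_toWord, h.2⟩,
        FreeGroup.mk_toWord⟩
    · rintro ⟨w, hw, rfl⟩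
      rw [wlen, toWord_mk_of_mem hw]
      exact ⟨(mem_level.1 hw).1, (mem_level.1 hw).2.2⟩
  rw [this, ← sum_measure_singleton, Finset.sum_congr rfl (g := fun _ => c), Finset.sum_const,
    Finset.card_image_of_injOn, nsmul_eq_mul]
  · intro w hw w' hw' h
    rw [← toWord_mk_of_mem hw, ← toWord_mk_of_mem hw', h]
  · intro g hg
    obtain ⟨w, hw, rfl⟩ := Finset.mem_image.1 hg
    exact hc _ (by rw [wlen, toWord_mk_of_mem hw, (mem_level.1 hw).1])

/-- A property that is rare on every sphere is rare for radial probability measures. -/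
lemma measure_le_of_card_le {μ : Measure (FreeGroup (Fin k))} [IsProbabilityMeasure μ]
    (hμ : ∀ g g', wlen g = wlen g' → μ {g} = μ {g'}) {T : List (Fin k × Bool) → Prop} {δ : ℝ}
    (hδ : 0 ≤ δ)
    (hT : ∀ ℓ, ((level (fun w => FreeGroup.IsReduced w ∧ T w) ℓ).card : ℝ) ≤
      δ * (level (FreeGroup.IsReduced (α := Fin k)) ℓ).card) :
    μ {g | T g.toWord} ≤ ENNReal.ofReal δ := by
  have key : ∀ T : List (Fin k × Bool) → Prop,
      μ {g | T g.toWord} = ∑' ℓ, μ {g | wlen g = ℓ ∧ T g.toWord} := by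
    intro T
    rw [← measure_iUnion]
    · congr 1
      ext g
      simp
    · intro ℓ ℓ' h
      refine Set.disjoint_left.2 fun g hg hg' => h (hg.1.symm.trans hg'.1)
    · exact fun _ => MeasurableSet.of_discrete
  have htot : ∑' ℓ, μ {g | wlen g = ℓ ∧ True} = 1 := by
    rw [← key fun _ => True]
    simp
  rw [key]
  calc _ ≤ ∑' ℓ, ENNReal.ofReal δ * μ {g | wlen g = ℓ ∧ True} := by
        refine ENNReal.tsum_le_tsum fun ℓ => ?_
        obtain ⟨c, hc⟩ := exists_measure_eq_card_mul hμ ℓ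
        rw [hc, hc fun _ => True, ← mul_assoc]
        gcongr
        simp only [and_true]
        rw [← ENNReal.ofReal_natCast, ← ENNReal.ofReal_natCast, ← ENNReal.ofReal_mul hδ]
        exact ENNReal.ofReal_le_ofReal (hT ℓ)
    _ = ENNReal.ofReal δ := by rw [ENNReal.tsum_mul_left, htot, mul_one]

/-- A union bound over pairs of positions. -/
lemma measure_exists_pair_le {μ : Measure (FreeGroup (Fin k))} [IsProbabilityMeasure μ]
    (hμ : ∀ g g', wlen g = wlen g' → μ {g} = μ {g'})
    {T : ℕ → ℕ → List (Fin k × Bool) → Prop} {δ : ℝ} (hδ : 0 ≤ δ)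
    (hT : ∀ a b ℓ, ((level (fun w => FreeGroup.IsReduced w ∧ T a b w) ℓ).card : ℝ) ≤
      δ * (level (FreeGroup.IsReduced (α := Fin k)) ℓ).card) (M : ℕ) :
    μ {g | ∃ a ≤ M, ∃ b ≤ M, T a b g.toWord} ≤ ENNReal.ofReal ((M + 1) ^ 2 * δ) := by
  calc _ ≤ μ (⋃ x ∈ Finset.range (M + 1) ×ˢ Finset.range (M + 1), {g | T x.1 x.2 g.toWord}) := by
        refine measure_mono ?_
        rintro g ⟨a, ha, b, hb, h⟩
        simp only [Set.mem_iUnion]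
        exact ⟨(a, b), by simp; omega, h⟩
    _ ≤ ∑ x ∈ Finset.range (M + 1) ×ˢ Finset.range (M + 1), ENNReal.ofReal δ :=
        (measure_biUnion_finset_le _ _).trans
          (Finset.sum_le_sum fun x _ => measure_le_of_card_le hμ hδ (hT x.1 x.2))
    _ = _ := by
        rw [Finset.sum_const, Finset.card_product, Finset.card_range, nsmul_eq_mul,
          ENNReal.ofReal_mul (by positivity), ← ENNReal.ofReal_natCast]
        push_cast
        ring_nf

lemma pi_pair_le {p : ℕ} (μ : Fin p → Measure (FreeGroup (Fin k)))
    [∀ i, IsProbabilityMeasure (μ i)] {i j : Fin p} (hij : i ≠ j)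
    (A : FreeGroup (Fin k) → FreeGroup (Fin k) → Prop) {δ : ENNReal}
    (hA : ∀ g, μ j {h | A g h} ≤ δ) :
    Measure.pi μ {w | A (w i) (w j)} ≤ δ := by
  have hind := (ProbabilityTheory.iIndepFun_pi (μ := μ) (X := fun _ => id)
    fun _ => aemeasurable_id).indepFun hij
  have hmap := (ProbabilityTheory.indepFun_iff_map_prod_eq_prod_map_map
    (measurable_pi_apply i).aemeasurable (measurable_pi_apply j).aemeasurable).1 hind
  have hi := (measurePreserving_eval μ i).map_eq
  have hj := (measurePreserving_eval μ j).map_eq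
  have hS : MeasurableSet {x : FreeGroup (Fin k) × FreeGroup (Fin k) | A x.1 x.2} :=
    MeasurableSet.of_discrete
  have : Measure.pi μ {w | A (w i) (w j)} =
      ((μ i).prod (μ j)) {x | A x.1 x.2} := by
    have h := Measure.map_apply ((measurable_pi_apply i).prodMk (measurable_pi_apply j)) hS
      (μ := Measure.pi μ)
    have hmap' : Measure.map (fun w : Fin p → FreeGroup (Fin k) => (w i, w j)) (Measure.pi μ) =
      (μ i).prod (μ j) := by
      rw [← hi, ← hj]; exact hmap
    rw [hmap'] at h
    exact h.symm
  rw [this, Measure.prod_apply hS]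
  calc _ ≤ ∫⁻ _, δ ∂(μ i) := lintegral_mono fun g => hA g
    _ = δ := by simp

end Radial

lemma ExpDecay.mono {f g : ℕ → ENNReal} (hg : ExpDecay g) (h : ∀ n, f n ≤ g n) : ExpDecay f := by
  obtain ⟨C, hC, κ, hκ, hb⟩ := hg
  exact ⟨C, hC, κ, hκ, fun n => (h n).trans (hb n)⟩

lemma ExpDecay.add {f g : ℕ → ENNReal} (hf : ExpDecay f) (hg : ExpDecay g) :
    ExpDecay fun n => f n + g n := by
  obtain ⟨C, hC, κ, hκ, hb⟩ := hf
  obtain ⟨C', hC', κ', hκ', hb'⟩ := hg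
  refine ⟨C + C', by positivity, min κ κ', lt_min hκ hκ', fun n => ?_⟩
  have hmin : 0 < min κ κ' := lt_min (by linarith) (by linarith)
  rw [add_div, ENNReal.ofReal_add (by positivity) (by positivity)]
  refine add_le_add ((hb n).trans ?_) ((hb' n).trans ?_)
  · exact ENNReal.ofReal_le_ofReal (by gcongr; exact min_le_left _ _)
  · exact ENNReal.ofReal_le_ofReal (by gcongr; exact min_le_right _ _)

lemma ExpDecay.sum {ι : Type*} (s : Finset ι) {f : ι → ℕ → ENNReal}
    (hf : ∀ i ∈ s, ExpDecay (f i)) : ExpDecay fun n => ∑ i ∈ s, f i n := by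
  classical
  induction s using Finset.induction_on with
  | empty => exact ⟨1, one_pos, 2, one_lt_two, fun n => by simp⟩
  | insert i s hi ih =>
    simp only [Finset.sum_insert hi]
    exact (hf i (Finset.mem_insert_self i s)).add
      (ih fun j hj => hf j (Finset.mem_insert_of_mem hj))

lemma expDecay_of_ratio {k : ℕ} (hk : 2 ≤ k) {β : ℝ} (hβ : 0 < β) :
    ∃ θ > 0, ExpDecay fun n : ℕ => ENNReal.ofReal
      ((⌊Real.exp (θ * n)⌋₊ + 1 : ℝ) ^ 2 * (2 * ratio k ^ (⌊β * n⌋₊ / 2))) := by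
  have hr := ratio_pos hk
  obtain ⟨c, hc, hrc⟩ : ∃ c > 0, ratio k = Real.exp (-c) :=
    ⟨-Real.log (ratio k), neg_pos.2 (Real.log_neg hr (ratio_lt_one hk)), by
      rw [neg_neg, Real.exp_log hr]⟩
  refine ⟨c * β / 8, by positivity, 8 * Real.exp c, by positivity, Real.exp (c * β / 4),
    Real.one_lt_exp_iff.2 (by positivity), fun n => ENNReal.ofReal_le_ofReal ?_⟩
  have h1 : (⌊Real.exp (c * β / 8 * n)⌋₊ : ℝ) + 1 ≤ 2 * Real.exp (c * β / 8 * n) := by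
    have := Nat.floor_le (Real.exp_pos (c * β / 8 * n)).le
    have := Real.one_le_exp (x := c * β / 8 * n) (by positivity)
    linarith
  have h2 : ratio k ^ (⌊β * n⌋₊ / 2) ≤ Real.exp (c - c * β / 2 * n) := by
    rw [hrc, ← Real.exp_nat_mul, Real.exp_le_exp]
    have h3 := Nat.lt_floor_add_one (β * n)
    have h4 : (⌊β * n⌋₊ : ℝ) ≤ 2 * (⌊β * n⌋₊ / 2 : ℕ) + 1 := by
      exact_mod_cast (by omega : ⌊β * n⌋₊ ≤ 2 * (⌊β * n⌋₊ / 2) + 1)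
    nlinarith
  calc _ ≤ (2 * Real.exp (c * β / 8 * n)) ^ 2 * (2 * Real.exp (c - c * β / 2 * n)) := by
        gcongr
    _ = 8 * Real.exp c / Real.exp (c * β / 4) ^ n := by
        rw [eq_div_iff (by positivity), mul_pow, ← Real.exp_nat_mul, ← Real.exp_nat_mul]
        calc _ = 8 * (Real.exp ((2 : ℕ) * (c * β / 8 * n)) * Real.exp (c - c * β / 2 * n) *
              Real.exp (n * (c * β / 4))) := by ring
          _ = _ := by
            rw [← Real.exp_add, ← Real.exp_add]
            congr 2
            push_cast
            ring

lemma pi_matchAt_le {k p : ℕ} (hk : 2 ≤ k) (μ : Fin p → Measure (FreeGroup (Fin k)))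
    [∀ i, IsProbabilityMeasure (μ i)]
    (hμ : ∀ i (g g' : FreeGroup (Fin k)), wlen g = wlen g' → μ i {g} = μ i {g'})
    (i j : Fin p) (M m : ℕ) (r : Bool) (f : Equiv.Perm (Fin k × Bool))
    (hf : r = false → f ≠ 1 ∧ ∀ a, f (invLetter a) = invLetter (f a)) :
    Measure.pi μ {w | wlen (w i) ≤ M ∧ wlen (w j) ≤ M ∧
      ∃ a b, MatchAt r m f a b (w i).toWord (w j).toWord} ≤
      ENNReal.ofReal ((M + 1) ^ 2 * (2 * ratio k ^ (m / 2))) := by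
  have hδ : 0 ≤ 2 * ratio k ^ (m / 2) := by have := ratio_pos hk; positivity
  have hsub : ∀ g h : FreeGroup (Fin k), (wlen g ≤ M ∧ wlen h ≤ M ∧
      ∃ a b, MatchAt r m f a b g.toWord h.toWord) →
      ∃ a ≤ M, ∃ b ≤ M, MatchAt r m f a b g.toWord h.toWord := by
    rintro g h ⟨hg, hh, a, b, hab⟩
    have h1 := hab.1
    have h2 := hab.2.1
    rw [wlen] at hg hh
    exact ⟨a, by omega, b, by omega, hab⟩
  have hmono : {w : Fin p → FreeGroup (Fin k) | wlen (w i) ≤ M ∧ wlen (w j) ≤ M ∧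
      ∃ a b, MatchAt r m f a b (w i).toWord (w j).toWord} ⊆
      {w | ∃ a ≤ M, ∃ b ≤ M, MatchAt r m f a b (w i).toWord (w j).toWord} :=
    fun w hw => hsub _ _ hw
  refine (measure_mono hmono).trans ?_
  rcases eq_or_ne i j with rfl | hij
  · refine le_of_eq_of_le ?_ (measure_exists_pair_le (hμ i) hδ
      (T := fun a b w => MatchAt r m f a b w w)
      (fun a b ℓ => card_self_matchAt_le hk r ℓ m f hf a b) M)
    exact (measurePreserving_eval μ i).measure_preimage
      (s := {g | ∃ a ≤ M, ∃ b ≤ M, MatchAt r m f a b g.toWord g.toWord})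
      MeasurableSet.of_discrete.nullMeasurableSet
  · exact pi_pair_le μ hij (fun g h => ∃ a ≤ M, ∃ b ≤ M, MatchAt r m f a b g.toWord h.toWord)
      fun g => measure_exists_pair_le (hμ j) hδ
        (fun a b ℓ => card_matchAt_le hk r ℓ m f a b g.toWord) M

/-- `μ n i` is the distribution of `w_{i,n}`; independence is expressed
by the product measure. Under radial symmetry, positive drift with constant `L`, and
subexponential growth, for fixed `0 < β < L/2` and a relabeling automorphism `φ ≠ id`,
with probability going to 1 exponentially fast there is no reduced word `u` of length
`⌊βn⌋` such that `u` is a subword of some `w_{i,n}^{±1}` and `φ(u)` is a subword of some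
`w_{j,n}^{±1}`. -/
theorem no_relabeled_common_subword (k p : ℕ) (hk : 2 ≤ k) (hp : 1 ≤ p)
    (μ : ℕ → Fin p → Measure (FreeGroup (Fin k)))
    (hprob : ∀ n i, IsProbabilityMeasure (μ n i))
    (hradial : ∀ n i (g g' : FreeGroup (Fin k)), wlen g = wlen g' →
      μ n i {g} = μ n i {g'})
    (L : ℝ) (hL : 0 < L)
    (hdrift : ∀ i, ExpDecay (fun n => μ n i {g | ¬ (L * n < (wlen g : ℝ))}))
    (hsubexp : ∀ θ : ℝ, 0 < θ → ∀ i,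
      ExpDecay (fun n => μ n i {g | ¬ ((wlen g : ℝ) ≤ Real.exp (θ * n))}))
    (β : ℝ) (hβ0 : 0 < β) (hβL : β < L / 2)
    (φ : FreeGroup (Fin k) ≃* FreeGroup (Fin k)) (hφrel : IsRelabeling φ)
    (hφne : φ ≠ MulEquiv.refl (FreeGroup (Fin k))) :
    ExpDecay (fun n =>
      Measure.pi (μ n)
        {w : Fin p → FreeGroup (Fin k) |
          ∃ u : List (Fin k × Bool), FreeGroup.reduce u = u ∧
            u.length = Nat.floor (β * n) ∧
            (∃ (i : Fin p) (ε : Bool), u <:+: signedWord (w i) ε) ∧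
            (∃ (j : Fin p) (ε : Bool),
              FreeGroup.toWord (φ (FreeGroup.mk u)) <:+: signedWord (w j) ε)}) := by
  obtain ⟨f, hfinv, hf⟩ := hφrel.exists_perm
  have hf1 : f ≠ 1 := by
    rintro rfl
    refine hφne (MulEquiv.ext fun g => ?_)
    rw [← FreeGroup.mk_toWord (x := g), hf]
    simp
  obtain ⟨θ, hθ, hdecay⟩ := expDecay_of_ratio hk hβ0
  refine ((ExpDecay.sum Finset.univ fun i _ => hsubexp θ hθ i).add
    (ExpDecay.sum (Finset.univ : Finset (Fin p × Fin p × Bool)) fun _ _ => hdecay)).mono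
    fun n => ?_
  have := hprob n
  set M := ⌊Real.exp (θ * n)⌋₊
  set m := ⌊β * n⌋₊
  let F : Bool → Equiv.Perm (Fin k × Bool) := fun r => if r then (invPerm k).trans f else f
  let B : Fin p × Fin p × Bool → Set (Fin p → FreeGroup (Fin k)) := fun x =>
    {w | wlen (w x.1) ≤ M ∧ wlen (w x.2.1) ≤ M ∧
      ∃ a b, MatchAt x.2.2 m (F x.2.2) a b (w x.1).toWord (w x.2.1).toWord}
  let A : Fin p → Set (Fin p → FreeGroup (Fin k)) := fun i =>
    Function.eval i ⁻¹' {g | ¬ ((wlen g : ℝ) ≤ Real.exp (θ * n))}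
  calc _ ≤ Measure.pi (μ n) ((⋃ i, A i) ∪ ⋃ x, B x) := measure_mono ?_
    _ ≤ ∑ i, Measure.pi (μ n) (A i) + ∑ x, Measure.pi (μ n) (B x) :=
      (measure_union_le _ _).trans
        (add_le_add (measure_iUnion_fintype_le _ _) (measure_iUnion_fintype_le _ _))
    _ ≤ _ := add_le_add (Finset.sum_le_sum fun i _ => ?_) (Finset.sum_le_sum fun x _ => ?_)
  · rintro w ⟨u, hu, hlen, ⟨i, ε, hi⟩, j, δ, hj⟩
    by_cases hw : w ∈ ⋃ i, A i
    · exact Or.inl hw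
    · have hwM : ∀ i, wlen (w i) ≤ M := by
        intro i
        by_contra h
        refine hw (Set.mem_iUnion.2 ⟨i, fun h' => h (Nat.le_floor h')⟩)
      obtain ⟨r, hr⟩ := exists_matchAt hfinv hf hu hi hj
      rw [hlen] at hr
      exact Or.inr (Set.mem_iUnion.2 ⟨(i, j, r), hwM i, hwM j, hr⟩)
  · exact ((measurePreserving_eval (μ n) i).measure_preimage
      MeasurableSet.of_discrete.nullMeasurableSet).le
  · refine pi_matchAt_le hk (μ n) (hradial n) x.1 x.2.1 M m x.2.2 (F x.2.2) fun hx => ?_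
    simp only [F, hx, Bool.false_eq_true, if_false]
    exact ⟨hf1, hfinv⟩

end
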